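/- κ(v) = add(v⁰), i.e. the least cardinality of a shattering v-matrix equals the additivity number of the σ-ideal of v⁰-sets. -/

import Mathlib

open Set

/-- `A`, `B` form a segment when `A ⊆ B` and `B \ A` is infinite. -/
def IsSeg (A B : Set ℕ) : Prop := A ⊆ B ∧ (B \ A).Infinite

/-- The segment `⟨A,B⟩ = {X ∈ [ω]^ω : A ⊆ X ⊆ B}`. -/
def Seg (A B : Set ℕ) : Set (Set ℕ) := {X | X.Infinite ∧ A ⊆ X ∧ X ⊆ B}

/-- `X ⊆* Y` : the set `X \ Y` is finite. -/
def AlmostSub (X Y : Set ℕ) : Prop := (X \ Y).Finite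

/-- The *-segment `⟨A,B⟩* = {X ∈ [ω]^ω : A ⊆* X ⊆* B}`. -/
def StarSeg (A B : Set ℕ) : Set (Set ℕ) := {X | X.Infinite ∧ AlmostSub A X ∧ AlmostSub X B}

/-- `S` is a v⁰-set: every segment contains a segment disjoint from `S`. -/
def IsVZero (S : Set (Set ℕ)) : Prop :=
  ∀ A B, IsSeg A B → ∃ C D, IsSeg C D ∧ Seg C D ⊆ Seg A B ∧ Seg C D ∩ S = ∅

/-- `S` is a v-set: every segment contains a segment inside `S` or disjoint from `S`. -/
def IsVSet (S : Set (Set ℕ)) : Prop :=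
  ∀ A B, IsSeg A B → ∃ C D, IsSeg C D ∧ Seg C D ⊆ Seg A B ∧
    (Seg C D ⊆ S ∨ Seg C D ∩ S = ∅)

/-- A set of infinite subsets of `ℕ` is a *-segment if it is of the form `⟨A,B⟩*`. -/
def IsStarSeg (P : Set (Set ℕ)) : Prop := ∃ A B, IsSeg A B ∧ P = StarSeg A B

/-- Two *-segments are *-disjoint when their intersection is countable. -/
def StarDisjoint (P Q : Set (Set ℕ)) : Prop := (P ∩ Q).Countable

/-- A v-partition: a maximal family of pairwise *-disjoint *-segments. -/
def IsVPartition (P : Set (Set (Set ℕ))) : Prop :=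
  (∀ X ∈ P, IsStarSeg X) ∧
  (∀ X ∈ P, ∀ Y ∈ P, X ≠ Y → StarDisjoint X Y) ∧
  (∀ R, IsStarSeg R → R ∉ P → ∃ X ∈ P, ¬ StarDisjoint R X)

/-- `P` refines `Q`: every member of `P` is contained in some member of `Q`. -/
def Refines (P Q : Set (Set (Set ℕ))) : Prop := ∀ X ∈ P, ∃ Y ∈ Q, X ⊆ Y

/-- A v-matrix is a collection of v-partitions. -/
def IsVMatrix (H : Set (Set (Set (Set ℕ)))) : Prop := ∀ P ∈ H, IsVPartition P

/-- A v-matrix `H` is shattering: for every *-segment `⟨A,B⟩*` some partition in `H`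
has two distinct members whose intersections with `⟨A,B⟩*` are two different *-segments. -/
def Shattering (H : Set (Set (Set (Set ℕ)))) : Prop :=
  IsVMatrix H ∧ ∀ A B, IsSeg A B → ∃ P ∈ H, ∃ X ∈ P, ∃ Y ∈ P, X ≠ Y ∧
    IsStarSeg (X ∩ StarSeg A B) ∧ IsStarSeg (Y ∩ StarSeg A B) ∧
    X ∩ StarSeg A B ≠ Y ∩ StarSeg A B

/-- `κ(v)`: the least cardinality of a shattering v-matrix. -/
noncomputable def kappaV : Cardinal :=
  sInf {c : Cardinal | ∃ H : Set (Set (Set (Set ℕ))), Shattering H ∧ Cardinal.mk ↥H = c}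

/-- `add(v⁰)`: the additivity number of the ideal of v⁰-sets. -/
noncomputable def addV0 : Cardinal :=
  sInf {c : Cardinal | ∃ F : Set (Set (Set ℕ)),
    (∀ S ∈ F, IsVZero S) ∧ ¬ IsVZero (⋃₀ F) ∧ Cardinal.mk ↥F = c}

theorem finite_of_forall_mem_or {s t u : Set ℕ} (hs : s.Finite) (ht : t.Finite)
    (h : ∀ z ∈ u, z ∈ s ∨ z ∈ t) : u.Finite :=
  (hs.union ht).subset h

theorem exists_disjoint_infinite_subsets {E : Set ℕ} (hE : E.Infinite) :
    ∃ F G, F ⊆ E ∧ G ⊆ E ∧ F.Infinite ∧ G.Infinite ∧ Disjoint F G := by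
  let f := hE.natEmbedding
  have hinj : Function.Injective fun n => (f n : ℕ) :=
    Subtype.val_injective.comp f.injective
  refine ⟨range fun n => (f (2 * n) : ℕ), range fun n => (f (2 * n + 1) : ℕ), ?_, ?_, ?_, ?_, ?_⟩
  · rintro _ ⟨n, rfl⟩; exact (f _).2
  · rintro _ ⟨n, rfl⟩; exact (f _).2
  · exact infinite_range_of_injective fun a b h => by have := hinj h; omega
  · exact infinite_range_of_injective fun a b h => by have := hinj h; omega
  · rw [Set.disjoint_left]
    rintro _ ⟨n, rfl⟩ ⟨m, h⟩
    have := hinj h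
    omega

theorem exists_infinite_subset_diff_infinite {E I : Set ℕ} (hE : E.Infinite) (hI : I.Infinite) :
    ∃ F ⊆ E, F.Infinite ∧ (I \ F).Infinite := by
  by_cases h : (I \ E).Infinite
  · exact ⟨E, subset_rfl, hE, h⟩
  · have h' : (I ∩ E).Infinite := fun hfin => hI <|
      finite_of_forall_mem_or hfin (not_infinite.1 h) fun z hz => by
        by_cases hzE : z ∈ E
        exacts [.inl ⟨hz, hzE⟩, .inr ⟨hz, hzE⟩]
    obtain ⟨F, G, hF, hG, hFi, hGi, hd⟩ := exists_disjoint_infinite_subsets h'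
    exact ⟨F, fun z hz => (hF hz).2, hFi, hGi.mono fun z hz =>
      ⟨(hG hz).1, fun hz' => Set.disjoint_left.1 hd hz' hz⟩⟩

theorem AlmostSub.trans {X Y Z : Set ℕ} (h : AlmostSub X Y) (h' : AlmostSub Y Z) :
    AlmostSub X Z :=
  finite_of_forall_mem_or h h' fun z hz => by
    by_cases hy : z ∈ Y
    exacts [.inr ⟨hy, hz.2⟩, .inl ⟨hz.1, hy⟩]

theorem AlmostSub.of_subset {X Y : Set ℕ} (h : X ⊆ Y) : AlmostSub X Y := by
  simp [AlmostSub, sdiff_eq_empty.2 h]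

theorem countable_setOf_almostSub_almostSub (Y : Set ℕ) :
    {X | AlmostSub X Y ∧ AlmostSub Y X}.Countable := by
  have hc : {s : Set ℕ | s.Finite}.Countable := Countable.ofPred_finite
  refine (hc.image fun s => symmDiff Y s).mono ?_
  rintro X ⟨h1, h2⟩
  refine ⟨symmDiff Y X, ?_, symmDiff_symmDiff_cancel_left Y X⟩
  exact h2.union h1

theorem Seg_subset_StarSeg (A B : Set ℕ) : Seg A B ⊆ StarSeg A B :=
  fun _ h => ⟨h.1, .of_subset h.2.1, .of_subset h.2.2⟩

theorem IsSeg.infinite_right {A B : Set ℕ} (h : IsSeg A B) : B.Infinite :=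
  h.2.mono sdiff_subset

theorem IsSeg.right_mem {A B : Set ℕ} (h : IsSeg A B) : B ∈ Seg A B :=
  ⟨h.infinite_right, h.1, subset_rfl⟩

theorem StarSeg_mono {A B C D : Set ℕ} (h : AlmostSub A C) (h' : AlmostSub D B) :
    StarSeg C D ⊆ StarSeg A B :=
  fun _ hX => ⟨hX.1, h.trans hX.2.1, hX.2.2.trans h'⟩

theorem exists_inter_of_isSeg {C D : Set ℕ} (h : IsSeg C D) :
    ∃ X ∈ Seg C D, ∃ Y ∈ Seg C D, X ∩ Y = C := by
  obtain ⟨F, G, hF, hG, hFi, hGi, hd⟩ := exists_disjoint_infinite_subsets h.2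
  refine ⟨C ∪ F, ⟨hFi.mono subset_union_right, subset_union_left,
    union_subset h.1 fun z hz => (hF hz).1⟩, C ∪ G, ⟨hGi.mono subset_union_right,
    subset_union_left, union_subset h.1 fun z hz => (hG hz).1⟩, ?_⟩
  rw [← union_inter_distrib_left, hd.inter_eq, union_empty]

theorem subset_of_Seg_subset {A B C D : Set ℕ} (h : IsSeg C D) (hs : Seg C D ⊆ Seg A B) :
    A ⊆ C ∧ D ⊆ B := by
  obtain ⟨X, hX, Y, hY, hXY⟩ := exists_inter_of_isSeg h
  exact ⟨hXY ▸ subset_inter (hs hX).2.1 (hs hY).2.1, (hs h.right_mem).2.2⟩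

theorem Seg_mono {A B C D : Set ℕ} (h : A ⊆ C) (h' : D ⊆ B) : Seg C D ⊆ Seg A B :=
  fun _ hX => ⟨hX.1, h.trans hX.2.1, hX.2.2.trans h'⟩

theorem almostSub_of_StarSeg_subset {A B C D : Set ℕ} (h : IsSeg C D)
    (hs : StarSeg C D ⊆ StarSeg A B) : AlmostSub A C ∧ AlmostSub D B := by
  obtain ⟨X, hX, Y, hY, hXY⟩ := exists_inter_of_isSeg h
  refine ⟨?_, (hs (Seg_subset_StarSeg _ _ h.right_mem)).2.2⟩
  refine finite_of_forall_mem_or (hs (Seg_subset_StarSeg _ _ hX)).2.1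
    (hs (Seg_subset_StarSeg _ _ hY)).2.1 fun z hz => ?_
  have := hz.2
  rw [← hXY] at this
  by_cases hzX : z ∈ X
  · exact .inr ⟨hz.1, fun hzY => this ⟨hzX, hzY⟩⟩
  · exact .inl ⟨hz.1, hzX⟩

theorem isSeg_inter {A B C D : Set ℕ} (h : IsSeg A B)
    (hc : ¬ (StarSeg A B ∩ StarSeg C D).Countable) :
    IsSeg (A ∪ (C ∩ B)) (A ∪ (C ∩ B) ∪ (D ∩ B)) ∧
      StarSeg (A ∪ (C ∩ B)) (A ∪ (C ∩ B) ∪ (D ∩ B)) = StarSeg A B ∩ StarSeg C D := by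
  obtain ⟨x, ⟨hx, hAx, hxB⟩, -, hCx, hxD⟩ : (StarSeg A B ∩ StarSeg C D).Nonempty := by
    by_contra he
    exact hc (by simp [not_nonempty_iff_eq_empty.1 he])
  have hAD := hAx.trans hxD
  have hCB := hCx.trans hxB
  have hCD := hCx.trans hxD
  have heq : StarSeg (A ∪ (C ∩ B)) (A ∪ (C ∩ B) ∪ (D ∩ B)) = StarSeg A B ∩ StarSeg C D := by
    ext X
    constructor
    · rintro ⟨hX, h1, h2⟩
      have h3 : AlmostSub (A ∪ (C ∩ B) ∪ (D ∩ B)) B := .of_subset <|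
        union_subset (union_subset h.1 inter_subset_right) inter_subset_right
      have h4 : AlmostSub (A ∪ (C ∩ B) ∪ (D ∩ B)) D :=
        finite_of_forall_mem_or hAD hCD fun z => by
          simp only [mem_sdiff, mem_union, mem_inter_iff]; tauto
      have h5 : AlmostSub C X := finite_of_forall_mem_or hCB h1 fun z => by
          simp only [mem_sdiff, mem_union, mem_inter_iff]; tauto
      exact ⟨⟨hX, (AlmostSub.of_subset subset_union_left).trans h1, h2.trans h3⟩,
        hX, h5, h2.trans h4⟩
    · rintro ⟨⟨hX, h1, h2⟩, -, h3, h4⟩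
      refine ⟨hX, finite_of_forall_mem_or h1 h3 fun z => ?_,
        finite_of_forall_mem_or h2 h4 fun z => ?_⟩ <;>
      · simp only [mem_sdiff, mem_union, mem_inter_iff]; tauto
  refine ⟨⟨subset_union_left, fun hfin => hc ?_⟩, heq⟩
  rw [← heq]
  refine (countable_setOf_almostSub_almostSub (A ∪ (C ∩ B) ∪ (D ∩ B))).mono ?_
  rintro X ⟨-, h1, h2⟩
  exact ⟨h2, AlmostSub.trans hfin h1⟩

theorem IsStarSeg.inter {Q R : Set (Set ℕ)} (hQ : IsStarSeg Q) (hR : IsStarSeg R)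
    (hc : ¬ (Q ∩ R).Countable) : IsStarSeg (Q ∩ R) := by
  obtain ⟨A, B, hAB, rfl⟩ := hQ
  obtain ⟨C, D, hCD, rfl⟩ := hR
  have := isSeg_inter hAB hc
  exact ⟨_, _, this.1, this.2.symm⟩

/-- A segment splits into continuum many pairwise disjoint segments. -/
theorem exists_disjoint_isSeg_family {A B : Set ℕ} (h : IsSeg A B) :
    ∃ C D : Set ℕ → Set ℕ, (∀ Z, IsSeg (C Z) (D Z)) ∧ (∀ Z, Seg (C Z) (D Z) ⊆ Seg A B) ∧
      ∀ Z W, (Seg (C Z) (D Z) ∩ Seg (C W) (D W)).Nonempty → Z = W := by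
  let f := h.2.natEmbedding
  have hinj : Function.Injective fun n => (f n : ℕ) :=
    Subtype.val_injective.comp f.injective
  have hB : ∀ n, (f n : ℕ) ∈ B := fun n => (f n).2.1
  have hA : ∀ n, (f n : ℕ) ∉ A := fun n => (f n).2.2
  refine ⟨fun Z => A ∪ (fun n => (f (2 * n) : ℕ)) '' Z, fun Z => A ∪ (fun n => (f (2 * n) : ℕ)) '' Z
    ∪ range (fun n => (f (2 * n + 1) : ℕ)), fun Z => ⟨subset_union_left, ?_⟩, fun Z => ?_, ?_⟩
  · have : (range (fun n => (f (2 * n + 1) : ℕ))).Infinite :=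
      infinite_range_of_injective fun a b h => by have := hinj h; omega
    refine this.mono ?_
    rintro _ ⟨n, rfl⟩
    refine ⟨.inr ⟨n, rfl⟩, ?_⟩
    rintro (h1 | ⟨m, -, hm⟩)
    · exact hA _ h1
    · have := hinj hm; omega
  · refine Seg_mono subset_union_left (union_subset (union_subset h.1 ?_) ?_)
    · rintro _ ⟨n, -, rfl⟩; exact hB _
    · rintro _ ⟨n, rfl⟩; exact hB _
  · have key : ∀ Z W : Set ℕ, A ∪ (fun n => (f (2 * n) : ℕ)) '' Z ⊆
        A ∪ (fun n => (f (2 * n) : ℕ)) '' W ∪ range (fun n => (f (2 * n + 1) : ℕ)) → Z ⊆ W := by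
      intro Z W hs n hn
      rcases hs (.inr ⟨n, hn, rfl⟩) with (h1 | ⟨m, hm, h2⟩) | ⟨m, h2⟩
      · exact absurd h1 (hA _)
      · have := hinj h2
        rwa [show n = m by omega]
      · have := hinj h2; omega
    rintro Z W ⟨X, ⟨-, h1, h2⟩, -, h3, h4⟩
    exact (key Z W (h1.trans h4)).antisymm (key W Z (h3.trans h2))

theorem continuum_le_mk_Seg {A B : Set ℕ} (h : IsSeg A B) :
    Cardinal.continuum ≤ Cardinal.mk (Seg A B) := by
  obtain ⟨C, D, hS, hsub, hd⟩ := exists_disjoint_isSeg_family h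
  rw [← Cardinal.mk_set_nat]
  refine Cardinal.mk_le_of_injective (f := fun Z => ⟨D Z, hsub Z (hS Z).right_mem⟩) ?_
  intro Z W hZW
  have : D Z = D W := congrArg Subtype.val hZW
  exact hd Z W ⟨D Z, (hS Z).right_mem, this ▸ (hS W).right_mem⟩

theorem IsStarSeg.not_countable {Q : Set (Set ℕ)} (h : IsStarSeg Q) : ¬ Q.Countable := by
  obtain ⟨A, B, hAB, rfl⟩ := h
  intro hc
  have h1 := Cardinal.le_aleph0_iff_set_countable.2 (hc.mono (Seg_subset_StarSeg A B))
  exact absurd ((continuum_le_mk_Seg hAB).trans h1) (not_le.2 Cardinal.aleph0_lt_continuum)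

theorem exists_Seg_disjoint_of_mk_lt {A B : Set ℕ} {S : Set (Set ℕ)} (h : IsSeg A B)
    (hS : Cardinal.mk ↥(S ∩ Seg A B) < Cardinal.continuum) :
    ∃ C D, IsSeg C D ∧ Seg C D ⊆ Seg A B ∧ Seg C D ∩ S = ∅ := by
  obtain ⟨C, D, hS', hsub, hd⟩ := exists_disjoint_isSeg_family h
  by_contra! hne
  have hne' : ∀ Z, (Seg (C Z) (D Z) ∩ S).Nonempty := fun Z => hne _ _ (hS' Z) (hsub Z)
  choose x hx using hne'
  refine absurd hS (not_lt.2 ?_)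
  rw [← Cardinal.mk_set_nat]
  refine Cardinal.mk_le_of_injective
    (f := fun Z => (⟨x Z, (hx Z).2, hsub Z (hx Z).1⟩ : ↥(S ∩ Seg A B))) ?_
  intro Z W hZW
  have : x Z = x W := congrArg Subtype.val hZW
  exact hd Z W ⟨x Z, (hx Z).1, this ▸ (hx W).1⟩

theorem exists_Seg_subset_of_inter {A B : Set ℕ} {Q : Set (Set ℕ)} (h : IsSeg A B)
    (hQ : IsStarSeg Q) (hc : ¬ (StarSeg A B ∩ Q).Countable) :
    ∃ C D, IsSeg C D ∧ A ⊆ C ∧ D ⊆ B ∧ StarSeg C D = StarSeg A B ∩ Q := by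
  obtain ⟨C, D, hCD, rfl⟩ := hQ
  have := isSeg_inter h hc
  exact ⟨_, _, this.1, subset_union_left,
    union_subset (union_subset h.1 inter_subset_right) inter_subset_right, this.2⟩

theorem IsStarSeg.exists_subset_countable_inter {Q R : Set (Set ℕ)} (hQ : IsStarSeg Q)
    (hR : IsStarSeg R) (hQR : ¬ Q ⊆ R) :
    ∃ Q' ⊆ Q, IsStarSeg Q' ∧ (Q' ∩ R).Countable := by
  obtain ⟨A, B, hAB, rfl⟩ := hQ
  obtain ⟨C, D, -, rfl⟩ := hR
  obtain ⟨x, ⟨hx, hAx, hxB⟩, hxR⟩ := not_subset.1 hQR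
  by_cases hCx : (C \ x).Infinite
  · obtain ⟨F, hF, hFi, hI⟩ := exists_infinite_subset_diff_infinite hCx hAB.2
    refine ⟨StarSeg (A \ F) (B \ F), StarSeg_mono ?_ (.of_subset sdiff_subset),
      ⟨_, _, ⟨sdiff_subset_sdiff_left hAB.1, hI.mono fun z => ?_⟩, rfl⟩, ?_⟩
    · refine Set.Finite.subset hAx fun z hz => ⟨hz.1, fun hzx => ?_⟩
      have : z ∈ F := by by_contra hzF; exact hz.2 ⟨hz.1, hzF⟩
      exact (hF this).2 hzx
    · simp only [mem_sdiff]; tauto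
    · convert countable_empty
      rw [eq_empty_iff_forall_notMem]
      rintro y ⟨⟨-, -, h1⟩, -, h2, -⟩
      refine hFi (finite_of_forall_mem_or h1 h2 fun z hz => ?_)
      have := (hF hz).1
      simp only [mem_sdiff]; tauto
  · have hxD : (x \ D).Infinite := fun hfin => hxR ⟨hx, not_infinite.1 hCx, hfin⟩
    obtain ⟨F, hF, hFi, hI⟩ := exists_infinite_subset_diff_infinite hxD hAB.2
    refine ⟨StarSeg (A ∪ F) (B ∪ F), StarSeg_mono (.of_subset subset_union_left) ?_,
      ⟨_, _, ⟨union_subset_union_left _ hAB.1, hI.mono fun z => ?_⟩, rfl⟩, ?_⟩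
    · refine Set.Finite.subset hxB fun z hz => ?_
      rcases hz with ⟨h1 | h1, h2⟩
      exacts [absurd h1 h2, ⟨(hF h1).1, h2⟩]
    · simp only [mem_sdiff, mem_union]; tauto
    · convert countable_empty
      rw [eq_empty_iff_forall_notMem]
      rintro y ⟨⟨-, h1, -⟩, -, -, h2⟩
      refine hFi (finite_of_forall_mem_or h1 h2 fun z hz => ?_)
      have := (hF hz).2
      simp only [mem_sdiff, mem_union]; tauto

/-- Lower bounds of decreasing sequences of segments, with a modification below a prescribed
threshold bringing almost members into the segments of the sequence. -/
theorem exists_isSeg_limit {C D : ℕ → Set ℕ} {k : ℕ → ℕ} (hC : Monotone C) (hD : Antitone D)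
    (hCD : ∀ n, C n ⊆ D n) (hk : StrictMono k) (hkD : ∀ n, k n ∈ D n \ C n) :
    ∃ C' D', IsSeg C' D' ∧ ∀ y ∈ StarSeg C' D', ∃ M, ∀ N ≥ M,
      ∃ y' ∈ Seg (C (N + 1)) (D (N + 1)), ∀ z > k N, z ∈ y ↔ z ∈ y' := by
  refine ⟨(⋃ n, C n) \ range k, (⋃ n, C n) \ range k ∪ range k,
    ⟨subset_union_left, ?_⟩, ?_⟩
  · exact (infinite_range_of_injective hk.injective).mono fun z hz => ⟨.inr hz, fun h => h.2 hz⟩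
  · rintro y ⟨hy, h1, h2⟩
    obtain ⟨M, hM⟩ := (h1.union h2).bddAbove
    refine ⟨M, fun N hN => ⟨{z | z ∈ y ∧ k N < z} ∪ {z | z ∈ C (N + 1) ∧ z ≤ k N},
      ⟨?_, ?_, ?_⟩, ?_⟩⟩
    · refine fun hfin => hy (finite_of_forall_mem_or hfin (finite_Iic (k N)) fun z hz => ?_)
      by_cases hzk : z ≤ k N
      · exact .inr hzk
      · exact .inl (.inl ⟨hz, not_le.1 hzk⟩)
    · intro z hz
      by_cases hzk : z ≤ k N
      · exact .inr ⟨hz, hzk⟩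
      · refine .inl ⟨?_, not_le.1 hzk⟩
        by_contra hzy
        have hzr : z ∉ range k := by
          rintro ⟨m, rfl⟩
          have : N < m := hk.lt_iff_lt.1 (not_le.1 hzk)
          exact (hkD m).2 (hC this hz)
        have : z ≤ M := hM (.inl ⟨⟨mem_iUnion.2 ⟨_, hz⟩, hzr⟩, hzy⟩)
        have := hk.id_le N
        simp only [id] at this
        omega
    · rintro z (⟨hz, hzk⟩ | ⟨hz, -⟩)
      · by_cases hzD : z ∈ (⋃ n, C n) \ range k ∪ range k
        · rcases hzD with ⟨hzC, -⟩ | ⟨m, rfl⟩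
          · obtain ⟨m, hm⟩ := mem_iUnion.1 hzC
            exact hD (le_max_right m (N + 1)) (hCD _ (hC (le_max_left m (N + 1)) hm))
          · have : N < m := hk.lt_iff_lt.1 hzk
            exact hD this (hkD m).1
        · have : z ≤ M := hM (.inr ⟨hz, hzD⟩)
          have := hk.id_le N
          simp only [id] at this
          omega
      · exact hCD _ hz
    · intro z hz
      simp only [mem_union, mem_ofPred_eq]
      constructor
      · exact fun h => .inl ⟨h, hz⟩
      · rintro (h | h)
        exacts [h.1, absurd h.2 (not_le.2 hz)]

theorem mem_StarSeg_of_agree {A B y y' : Set ℕ} {k : ℕ} (hy : y' ∈ StarSeg A B)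
    (h : ∀ z > k, z ∈ y ↔ z ∈ y') : y ∈ StarSeg A B := by
  have h1 : AlmostSub y' y := (finite_Iic k).subset fun z hz => by
    by_contra hzk
    exact hz.2 ((h z (not_le.1 hzk)).2 hz.1)
  have h2 : AlmostSub y y' := (finite_Iic k).subset fun z hz => by
    by_contra hzk
    exact hz.2 ((h z (not_le.1 hzk)).1 hz.1)
  exact ⟨fun hfin => hy.1 (finite_of_forall_mem_or hfin h1 fun z hz => by
    by_cases hzy : z ∈ y
    exacts [.inl hzy, .inr ⟨hz, hzy⟩]), hy.2.1.trans h1, h2.trans hy.2.2⟩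

/-- Decreasing sequences of *-segments have lower bounds. -/
theorem exists_isStarSeg_subset_of_antitone {Q : ℕ → Set (Set ℕ)} (hQ : ∀ n, IsStarSeg (Q n))
    (hanti : ∀ n, Q (n + 1) ⊆ Q n) : ∃ R, IsStarSeg R ∧ ∀ n, R ⊆ Q n := by
  have hstep : ∀ n A B, IsSeg A B → StarSeg A B = Q n →
      ∃ C D, IsSeg C D ∧ A ⊆ C ∧ D ⊆ B ∧ StarSeg C D = Q (n + 1) := by
    intro n A B hAB hq
    have hi : StarSeg A B ∩ Q (n + 1) = Q (n + 1) := by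
      rw [hq]; exact inter_eq_right.2 (hanti n)
    obtain ⟨C, D, h1, h2, h3, h4⟩ := exists_Seg_subset_of_inter hAB (hQ (n + 1))
      (by rw [hi]; exact (hQ _).not_countable)
    exact ⟨C, D, h1, h2, h3, h4.trans hi⟩
  choose! C' D' hS hC hD hq using hstep
  obtain ⟨A, B, hAB, h0⟩ := hQ 0
  let s : ℕ → Set ℕ × Set ℕ := fun n =>
    Nat.rec (A, B) (fun n p => (C' n p.1 p.2, D' n p.1 p.2)) n
  have hs : ∀ n, IsSeg (s n).1 (s n).2 ∧ StarSeg (s n).1 (s n).2 = Q n := by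
    intro n
    induction n with
    | zero => exact ⟨hAB, h0.symm⟩
    | succ n ih => exact ⟨hS n _ _ ih.1 ih.2, hq n _ _ ih.1 ih.2⟩
  have hmono : Monotone fun n => (s n).1 :=
    monotone_nat_of_le_succ fun n => hC n _ _ (hs n).1 (hs n).2
  have hant : Antitone fun n => (s n).2 :=
    antitone_nat_of_succ_le fun n => hD n _ _ (hs n).1 (hs n).2
  obtain ⟨k, hk, hkD⟩ := Filter.extraction_forall_of_frequently
    (P := fun n k => k ∈ (s n).2 \ (s n).1)
    fun n => Nat.frequently_atTop_iff_infinite.2 (hs n).1.2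
  obtain ⟨C, D, hCD, hlim⟩ := exists_isSeg_limit hmono hant (fun n => (hs n).1.1) hk hkD
  refine ⟨_, ⟨C, D, hCD, rfl⟩, fun n y hy => ?_⟩
  obtain ⟨M, hM⟩ := hlim y hy
  obtain ⟨y', hy', hag⟩ := hM (max M n) (le_max_left _ _)
  have := mem_StarSeg_of_agree (Seg_subset_StarSeg _ _ hy') hag
  have hQa : Antitone Q := antitone_nat_of_succ_le hanti
  exact hQa (by omega) ((hs (max M n + 1)).2.subset this)

theorem IsVZero.union {S T : Set (Set ℕ)} (hS : IsVZero S) (hT : IsVZero T) :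
    IsVZero (S ∪ T) := by
  intro A B h
  obtain ⟨C, D, hCD, h1, h2⟩ := hS A B h
  obtain ⟨E, F, hEF, h3, h4⟩ := hT C D hCD
  refine ⟨E, F, hEF, h3.trans h1, ?_⟩
  rw [inter_union_distrib_left, h4, union_empty]
  exact subset_empty_iff.1 ((inter_subset_inter_left _ h3).trans h2.subset)

theorem IsVZero.biUnion {ι : Type*} {S : ι → Set (Set ℕ)} (s : Finset ι)
    (hS : ∀ i ∈ s, IsVZero (S i)) : IsVZero (⋃ i ∈ s, S i) := by
  classical
  induction s using Finset.induction_on with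
  | empty => exact fun A B h => ⟨A, B, h, subset_rfl, by simp⟩
  | insert i s _ ih =>
    rw [Finset.set_biUnion_insert]
    exact (hS i (Finset.mem_insert_self i s)).union
      (ih fun j hj => hS j (Finset.mem_insert_of_mem hj))

theorem IsVZero.modify {S : Set (Set ℕ)} (hS : IsVZero S) (k : ℕ) (E : Set ℕ) (hE : E ⊆ Iic k) :
    IsVZero {y | y \ Iic k ∪ E ∈ S} := by
  intro A B h
  have hseg : IsSeg (A \ Iic k ∪ E) (B \ Iic k ∪ E) := by
    refine ⟨union_subset_union_left _ (sdiff_subset_sdiff_left h.1), fun hfin => h.2 <|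
      finite_of_forall_mem_or hfin (finite_Iic k) fun z => ?_⟩
    have := @hE z
    simp only [mem_sdiff, mem_union]; tauto
  obtain ⟨C, D, hCD, hsub, hemp⟩ := hS _ _ hseg
  obtain ⟨hC, hD⟩ := subset_of_Seg_subset hCD hsub
  refine ⟨C \ Iic k ∪ A ∩ Iic k, D \ Iic k ∪ A ∩ Iic k,
    ⟨union_subset_union_left _ (sdiff_subset_sdiff_left hCD.1), fun hfin => hCD.2 <|
      finite_of_forall_mem_or hfin (finite_Iic k) fun z => ?_⟩, Seg_mono ?_ ?_, ?_⟩
  · simp only [mem_sdiff, mem_union, mem_inter_iff]; tauto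
  · intro z
    have := @hC z
    simp only [mem_sdiff, mem_union, mem_inter_iff] at *; tauto
  · intro z
    have := @hD z
    have := @h.1 z
    have := @hE z
    simp only [mem_sdiff, mem_union, mem_inter_iff] at *; tauto
  · rw [eq_empty_iff_forall_notMem] at hemp ⊢
    rintro y ⟨⟨hy, h1, h2⟩, hyS⟩
    refine hemp _ ⟨⟨?_, ?_, ?_⟩, hyS⟩
    · exact fun hfin => hy (finite_of_forall_mem_or hfin (finite_Iic k) fun z => by
        simp only [mem_sdiff, mem_union]; tauto)
    · intro z hz
      have := @h1 z
      have := @hD z (hCD.1 hz)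
      simp only [mem_sdiff, mem_union, mem_inter_iff] at *; tauto
    · intro z
      have := @h2 z
      have := @hC z
      have := @hCD.1 z
      simp only [mem_sdiff, mem_union, mem_inter_iff] at *; tauto

theorem IsVZero.agree {S : Set (Set ℕ)} (hS : IsVZero S) (k : ℕ) :
    IsVZero {y' | ∃ y ∈ S, ∀ z > k, z ∈ y ↔ z ∈ y'} := by
  have h := IsVZero.biUnion (S := fun E : Finset ℕ => {y : Set ℕ | y \ Iic k ∪ ↑E ∈ S})
    (Finset.Iic k).powerset fun E hE => hS.modify k E fun z hz => by
      simpa using Finset.mem_powerset.1 hE hz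
  intro A B hAB
  obtain ⟨C, D, hCD, h1, h2⟩ := h A B hAB
  refine ⟨C, D, hCD, h1, subset_empty_iff.1 (h2 ▸ inter_subset_inter_right _ ?_)⟩
  rintro y' ⟨y, hy, hag⟩
  classical
  refine mem_iUnion₂.2 ⟨(Finset.Iic k).filter (· ∈ y), by simp, ?_⟩
  have heq : y' \ Iic k ∪ ↑((Finset.Iic k).filter (· ∈ y)) = y := by
    ext z
    by_cases hz : z ≤ k
    · simp [hz]
    · simp [hz, hag z (not_le.1 hz)]
  rw [mem_ofPred_eq, heq]
  exact hy

/-- A family of *-segments that is downward closed and dense. -/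
def IsOpenDense (𝒟 : Set (Set (Set ℕ))) : Prop :=
  (∀ Q ∈ 𝒟, ∀ R ⊆ Q, IsStarSeg R → R ∈ 𝒟) ∧ ∀ Q, IsStarSeg Q → ∃ R ⊆ Q, IsStarSeg R ∧ R ∈ 𝒟

theorem IsVZero.isOpenDense {S : Set (Set ℕ)} (hS : IsVZero S) :
    IsOpenDense {Q | Q ∩ S = ∅} := by
  refine ⟨fun Q hQ R hR _ => subset_empty_iff.1 ((inter_subset_inter_left _ hR).trans hQ.subset),
    ?_⟩
  rintro _ ⟨A, B, hAB, rfl⟩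
  have hstep : ∀ (k : ℕ) (A B : Set ℕ), IsSeg A B → ∃ C D, ∃ l, (IsSeg C D ∧ k < l ∧ l ∈ D \ C) ∧
      A ⊆ C ∧ D ⊆ B ∧ ∀ y ∈ S, ∀ y' ∈ Seg C D, ¬ ∀ z > k, z ∈ y ↔ z ∈ y' := by
    intro k A B h
    obtain ⟨C, D, hCD, hsub, hemp⟩ := hS.agree k A B h
    obtain ⟨hC, hD⟩ := subset_of_Seg_subset hCD hsub
    obtain ⟨l, hl, hkl⟩ := hCD.2.exists_gt k
    exact ⟨C, D, l, ⟨hCD, hkl, hl⟩, hC, hD, fun y hy y' hy' hag =>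
      (eq_empty_iff_forall_notMem.1 hemp) y' ⟨hy', y, hy, hag⟩⟩
  choose! C' D' l' hS' hC hD hav using hstep
  obtain ⟨k₀, hk₀⟩ := hAB.2.nonempty
  let s : ℕ → ℕ × Set ℕ × Set ℕ := fun n =>
    Nat.rec (k₀, A, B)
      (fun _ p => (l' p.1 p.2.1 p.2.2, C' p.1 p.2.1 p.2.2, D' p.1 p.2.1 p.2.2)) n
  have hs : ∀ n, IsSeg (s n).2.1 (s n).2.2 ∧ (s n).1 ∈ (s n).2.2 \ (s n).2.1 := by
    intro n
    induction n with
    | zero => exact ⟨hAB, hk₀⟩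
    | succ n ih => exact ⟨(hS' _ _ _ ih.1).1, (hS' _ _ _ ih.1).2.2⟩
  have hmono : Monotone fun n => (s n).2.1 :=
    monotone_nat_of_le_succ fun n => hC _ _ _ (hs n).1
  have hant : Antitone fun n => (s n).2.2 :=
    antitone_nat_of_succ_le fun n => hD _ _ _ (hs n).1
  have hk : StrictMono fun n => (s n).1 :=
    strictMono_nat_of_lt_succ fun n => (hS' _ _ _ (hs n).1).2.1
  obtain ⟨C, D, hCD, hlim⟩ :=
    exists_isSeg_limit hmono hant (fun n => (hs n).1.1) hk fun n => (hs n).2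
  refine ⟨StarSeg C D, fun y hy => ?_, ⟨C, D, hCD, rfl⟩, eq_empty_iff_forall_notMem.2 ?_⟩
  · obtain ⟨M, hM⟩ := hlim y hy
    obtain ⟨y', hy', hag⟩ := hM M le_rfl
    exact mem_StarSeg_of_agree (Seg_subset_StarSeg _ _
      (Seg_mono (hmono (Nat.zero_le (M + 1))) (hant (Nat.zero_le (M + 1))) hy')) hag
  · rintro y ⟨hy, hyS⟩
    obtain ⟨M, hM⟩ := hlim y hy
    obtain ⟨y', hy', hag⟩ := hM M le_rfl
    exact hav _ _ _ (hs M).1 y hyS y' hy' hag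

theorem isVZero_of_mk_lt_continuum {S : Set (Set ℕ)} (hS : Cardinal.mk S < Cardinal.continuum) :
    IsVZero S := fun _ _ h =>
  exists_Seg_disjoint_of_mk_lt h ((Cardinal.mk_le_mk_of_subset inter_subset_left).trans_lt hS)

/-- Every open dense family contains a v-partition. -/
theorem IsOpenDense.exists_isVPartition {𝒟 : Set (Set (Set ℕ))} (h : IsOpenDense 𝒟) :
    ∃ P ⊆ 𝒟, IsVPartition P := by
  obtain ⟨P, hP⟩ := zorn_subset {P : Set (Set (Set ℕ)) | (∀ X ∈ P, IsStarSeg X ∧ X ∈ 𝒟) ∧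
      ∀ X ∈ P, ∀ Y ∈ P, X ≠ Y → StarDisjoint X Y} fun c hc hchain => by
    refine ⟨⋃₀ c, ⟨?_, ?_⟩, fun s hs => subset_sUnion_of_mem hs⟩
    · rintro X ⟨s, hs, hX⟩
      exact (hc hs).1 X hX
    · rintro X ⟨s, hs, hX⟩ Y ⟨t, ht, hY⟩
      rcases hchain.total hs ht with hst | hst
      exacts [(hc ht).2 X (hst hX) Y hY, (hc hs).2 X hX Y (hst hY)]
  refine ⟨P, fun X hX => (hP.prop.1 X hX).2, fun X hX => (hP.prop.1 X hX).1, hP.prop.2, ?_⟩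
  intro R hR _
  by_contra! hdis
  obtain ⟨R', hR'R, hR', hR'D⟩ := h.2 R hR
  have hdis' : ∀ X ∈ P, StarDisjoint R' X := fun X hX =>
    (hdis X hX).mono (inter_subset_inter_left _ hR'R)
  have hmem : R' ∈ P := by
    refine hP.le_of_ge (y := insert R' P) ⟨?_, ?_⟩ (subset_insert _ _) (mem_insert _ _)
    · rintro X (rfl | hX)
      exacts [⟨hR', hR'D⟩, hP.prop.1 X hX]
    · rintro X (rfl | hX) Y (rfl | hY) hne
      · exact absurd rfl hne
      · exact hdis' Y hY
      · have := hdis' X hX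
        rwa [StarDisjoint, inter_comm] at this
      · exact hP.prop.2 X hX Y hY hne
  have := hdis' R' hmem
  rw [StarDisjoint, inter_self] at this
  exact hR'.not_countable this

theorem IsVPartition.exists_not_countable {P : Set (Set (Set ℕ))} (hP : IsVPartition P)
    {R : Set (Set ℕ)} (hR : IsStarSeg R) : ∃ X ∈ P, ¬ (R ∩ X).Countable := by
  by_cases h : R ∈ P
  · exact ⟨R, h, by rw [inter_self]; exact hR.not_countable⟩
  · exact hP.2.2 R hR h

theorem IsVPartition.eq_of_not_countable {P : Set (Set (Set ℕ))} (hP : IsVPartition P)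
    {X Y R : Set (Set ℕ)} (hX : X ∈ P) (hY : Y ∈ P) (hR : ¬ R.Countable) (hRX : R ⊆ X)
    (hRY : R ⊆ Y) : X = Y := by
  by_contra hne
  exact hR ((hP.2.1 X hX Y hY hne).mono (subset_inter hRX hRY))

theorem IsVPartition.isOpenDense {P : Set (Set (Set ℕ))} (hP : IsVPartition P) :
    IsOpenDense {Q | ∃ X ∈ P, Q ⊆ X} := by
  refine ⟨fun Q ⟨X, hX, hQX⟩ R hR _ => ⟨X, hX, hR.trans hQX⟩, fun Q hQ => ?_⟩
  obtain ⟨X, hX, hc⟩ := hP.exists_not_countable hQ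
  exact ⟨Q ∩ X, inter_subset_left, hQ.inter (hP.1 X hX) hc, X, hX, inter_subset_right⟩

/-- A *-segment not below a member of a v-partition meets two of its members. -/
theorem IsVPartition.exists_two {P : Set (Set (Set ℕ))} (hP : IsVPartition P)
    {Q : Set (Set ℕ)} (hQ : IsStarSeg Q) (hQP : ¬ ∃ X ∈ P, Q ⊆ X) :
    ∃ X ∈ P, ∃ Y ∈ P, X ≠ Y ∧ IsStarSeg (X ∩ Q) ∧ IsStarSeg (Y ∩ Q) := by
  push Not at hQP
  obtain ⟨X, hX, hc⟩ := hP.exists_not_countable hQ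
  obtain ⟨Q', hQ'Q, hQ', hcount⟩ := hQ.exists_subset_countable_inter (hP.1 X hX) (hQP X hX)
  obtain ⟨Y, hY, hc'⟩ := hP.exists_not_countable hQ'
  refine ⟨X, hX, Y, hY, ?_, ?_, ?_⟩
  · rintro rfl; exact hc' hcount
  · rw [inter_comm]; exact hQ.inter (hP.1 X hX) hc
  · rw [inter_comm]
    exact hQ.inter (hP.1 Y hY) fun h => hc' (h.mono (inter_subset_inter_left _ hQ'Q))

theorem IsOpenDense.inter {𝒟 ℰ : Set (Set (Set ℕ))} (h : IsOpenDense 𝒟) (h' : IsOpenDense ℰ) :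
    IsOpenDense (𝒟 ∩ ℰ) := by
  refine ⟨fun Q hQ R hR hRs => ⟨h.1 Q hQ.1 R hR hRs, h'.1 Q hQ.2 R hR hRs⟩, fun Q hQ => ?_⟩
  obtain ⟨R, hRQ, hR, hRD⟩ := h.2 Q hQ
  obtain ⟨T, hTR, hT, hTE⟩ := h'.2 R hR
  exact ⟨T, hTR.trans hRQ, hT, h.1 R hRD T hTR hT, hTE⟩

theorem exists_forall_mem_of_nat {𝒟 : ℕ → Set (Set (Set ℕ))} (h : ∀ n, IsOpenDense (𝒟 n))
    {Q : Set (Set ℕ)} (hQ : IsStarSeg Q) : ∃ R ⊆ Q, IsStarSeg R ∧ ∀ n, R ∈ 𝒟 n := by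
  have hstep := fun n => (h n).2
  choose! f hfsub hfstar hfmem using hstep
  let s : ℕ → Set (Set ℕ) := fun n => Nat.rec Q (fun n R => f n R) n
  have hs : ∀ n, IsStarSeg (s n) := by
    intro n
    induction n with
    | zero => exact hQ
    | succ n ih => exact hfstar n _ ih
  obtain ⟨R, hR, hRs⟩ := exists_isStarSeg_subset_of_antitone hs fun n => hfsub n _ (hs n)
  exact ⟨R, hRs 0, hR, fun n => (h n).1 _ (hfmem n _ (hs n)) R (hRs (n + 1)) hR⟩

theorem mk_Iio_ord_lt {c : Cardinal.{0}} (i : c.ord.ToType) : Cardinal.mk ↥(Iio i) < c := by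
  simpa using Cardinal.mk_Iio_lt i (by simp)

theorem mk_Iic_continuum_lt (i : Cardinal.continuum.{0}.ord.ToType) :
    Cardinal.mk ↥(Iic i) < Cardinal.continuum := by
  have h : Iic i ⊆ Iio i ∪ {i} := fun j hj => (lt_or_eq_of_le (mem_Iic.1 hj)).imp id id
  refine (Cardinal.mk_le_mk_of_subset h).trans_lt ((Cardinal.mk_union_le _ _).trans_lt ?_)
  refine Cardinal.add_lt_of_lt Cardinal.aleph0_le_continuum (mk_Iio_ord_lt i) ?_
  rw [Cardinal.mk_singleton]
  exact Cardinal.one_lt_aleph0.trans Cardinal.aleph0_lt_continuum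

theorem exists_notMem_of_countable_inter {A B : Set ℕ} (h : IsSeg A B) {ι : Type}
    (hι : Cardinal.mk ι < Cardinal.continuum) (T : ι → Set (Set ℕ))
    (hT : ∀ i, (T i).Countable) : ∃ x ∈ Seg A B, ∀ i, x ∉ T i := by
  by_contra! hcov
  have hsub : Seg A B ⊆ ⋃ i, T i := fun x hx => mem_iUnion.2 (hcov x hx)
  refine absurd ((continuum_le_mk_Seg h).trans (Cardinal.mk_le_mk_of_subset hsub)) (not_le.2 ?_)
  calc Cardinal.mk ↥(⋃ i, T i) ≤ Cardinal.sum fun i => Cardinal.mk ↥(T i) :=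
        Cardinal.mk_iUnion_le_sum_mk
    _ ≤ Cardinal.sum fun _ : ι => Cardinal.aleph0 :=
        Cardinal.sum_le_sum _ _ fun i => Cardinal.le_aleph0_iff_set_countable.2 (hT i)
    _ = Cardinal.mk ι * Cardinal.aleph0 := Cardinal.sum_const' _ _
    _ < Cardinal.continuum :=
        Cardinal.mul_lt_of_lt Cardinal.aleph0_le_continuum hι Cardinal.aleph0_lt_continuum

/-- For a v-partition there is a v⁰-set meeting every segment which meets continuum many members
of the partition. -/
theorem IsVPartition.exists_isVZero {P : Set (Set (Set ℕ))} (hP : IsVPartition P) :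
    ∃ S, IsVZero S ∧ ∀ A B, IsSeg A B →
      Cardinal.continuum ≤ Cardinal.mk ↥{X ∈ P | ¬ (StarSeg A B ∩ X).Countable} →
      (Seg A B ∩ S).Nonempty := by
  obtain ⟨e⟩ : Nonempty (Cardinal.continuum.{0}.ord.ToType ≃ Set ℕ × Set ℕ) := by
    rw [← Cardinal.eq, Cardinal.mk_ord_toType, Cardinal.mk_prod, Cardinal.mk_set_nat]
    simp
  let p := fun η => StarSeg (e η).1 (e η).2
  have hp : ∀ X ∈ P, ∃ η, X = p η := fun X hX => by
    obtain ⟨A, B, -, rfl⟩ := hP.1 X hX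
    exact ⟨e.symm (A, B), by simp [p]⟩
  let good := {ξ | IsSeg (e ξ).1 (e ξ).2 ∧
    Cardinal.continuum ≤ Cardinal.mk ↥{X ∈ P | ¬ (p ξ ∩ X).Countable}}
  have hx : ∀ ξ ∈ good, ∃ x ∈ Seg (e ξ).1 (e ξ).2, ∀ η ≤ ξ, p η ∈ P → x ∉ p η := by
    rintro ξ ⟨hseg, hcard⟩
    obtain ⟨X, ⟨hX, hXc⟩, hXp⟩ : ∃ X ∈ {X ∈ P | ¬ (p ξ ∩ X).Countable}, X ∉ p '' Iic ξ := by
      by_contra! hcov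
      exact absurd (hcard.trans ((Cardinal.mk_le_mk_of_subset hcov).trans Cardinal.mk_image_le))
        (not_le.2 (mk_Iic_continuum_lt ξ))
    obtain ⟨C, D, hCD, hC, hD, hint⟩ := exists_Seg_subset_of_inter hseg (hP.1 X hX) hXc
    obtain ⟨x, hx, hxT⟩ := exists_notMem_of_countable_inter hCD
      (ι := {η : Iic ξ // p η ∈ P}) ((Cardinal.mk_subtype_le _).trans_lt (mk_Iic_continuum_lt ξ))
      (fun η => X ∩ p η.1)
      fun η => hP.2.1 X hX _ η.2 fun heq => hXp ⟨η.1, η.1.2, heq.symm⟩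
    exact ⟨x, Seg_mono hC hD hx, fun η hη hηP hxη => hxT ⟨⟨η, hη⟩, hηP⟩
      ⟨(hint.subset (Seg_subset_StarSeg _ _ hx)).2, hxη⟩⟩
  choose! x hxseg hxav using hx
  refine ⟨x '' good, fun A B hAB => ?_, fun A B hAB hcard => ?_⟩
  · obtain ⟨X, hX, hXc⟩ := hP.exists_not_countable ⟨A, B, hAB, rfl⟩
    obtain ⟨η, rfl⟩ := hp X hX
    obtain ⟨C, D, hCD, hC, hD, hint⟩ := exists_Seg_subset_of_inter hAB (hP.1 _ hX) hXc
    obtain ⟨E, F, hEF, hsub, hemp⟩ := exists_Seg_disjoint_of_mk_lt (S := x '' good) hCD <| by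
      refine (Cardinal.mk_le_mk_of_subset (t := x '' Iio η) ?_).trans_lt
        (Cardinal.mk_image_le.trans_lt (mk_Iio_ord_lt η))
      rintro _ ⟨⟨ξ, hξ, rfl⟩, hmem⟩
      refine ⟨ξ, not_le.1 fun hle => hxav ξ hξ η hle hX ?_, rfl⟩
      exact (hint.subset (Seg_subset_StarSeg _ _ hmem)).2
    exact ⟨E, F, hEF, hsub.trans (Seg_mono hC hD), hemp⟩
  · have hg : e.symm (A, B) ∈ good := by simpa [good, p] using ⟨hAB, hcard⟩
    exact ⟨_, by simpa using hxseg _ hg, _, hg, rfl⟩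

/-- A tree of v-partitions without a common lower bound below `Q₀`: every *-segment below `Q₀`
meets continuum many members of one of the v-partitions. -/
theorem exists_continuum_le_mk {ι : Type} [LE ι] {P P' : ι → Set (Set (Set ℕ))}
    (hP : ∀ i, IsVPartition (P i)) (hP' : ∀ i, IsVPartition (P' i))
    (href : ∀ i j, j ≤ i → ∀ Q ∈ P' i, ∃ X ∈ P j, Q ⊆ X) {Q₀ : Set (Set ℕ)}
    (hshat : ∀ Q, IsStarSeg Q → Q ⊆ Q₀ → ∃ i, ¬ ∃ X ∈ P i, Q ⊆ X)
    (hbdd : ∀ a : ℕ → ι, ∃ i, ∀ n, a n ≤ i) {Q : Set (Set ℕ)} (hQ : IsStarSeg Q)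
    (hQ₀ : Q ⊆ Q₀) :
    ∃ i, Cardinal.continuum ≤ Cardinal.mk ↥{X ∈ P' i | ¬ (Q ∩ X).Countable} := by
  have hstep : ∀ R : {R // IsStarSeg R ∧ R ⊆ Q₀}, ∃ i, ∃ X : Bool → Set (Set ℕ),
      X true ≠ X false ∧ ∀ b, X b ∈ P i ∧ IsStarSeg (X b ∩ R) := by
    rintro ⟨R, hR, hRQ⟩
    obtain ⟨i, hi⟩ := hshat R hR hRQ
    obtain ⟨X, hX, Y, hY, hne, hXR, hYR⟩ := (hP i).exists_two hR hi
    exact ⟨i, fun b => cond b X Y, hne, fun b => by cases b <;> simp [*]⟩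
  choose idx X hne hX using hstep
  let node : List Bool → {R // IsStarSeg R ∧ R ⊆ Q₀} := fun l =>
    l.foldr (fun b R => ⟨X R b ∩ R, (hX R b).2, inter_subset_right.trans R.2.2⟩) ⟨Q, hQ, hQ₀⟩
  obtain ⟨g, hg⟩ := exists_surjective_nat (List Bool)
  obtain ⟨i, hi⟩ := hbdd fun n => idx (node (g n))
  have hi' : ∀ l, idx (node l) ≤ i := fun l => by
    obtain ⟨n, rfl⟩ := hg l
    exact hi n
  let path : (ℕ → Bool) → ℕ → List Bool := fun f n => Nat.rec [] (fun n l => f n :: l) n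
  have hlow : ∀ f, ∃ R, IsStarSeg R ∧ ∀ n, R ⊆ (node (path f n)).1 := fun f =>
    exists_isStarSeg_subset_of_antitone (fun n => (node (path f n)).2.1) fun n =>
      inter_subset_right
  choose R hR hRn using hlow
  choose p hp hpc using fun f => (hP' i).exists_not_countable (hR f)
  refine ⟨i, ?_⟩
  have hcard : Cardinal.mk (ℕ → Bool) = Cardinal.continuum := by simp
  rw [← hcard]
  refine Cardinal.mk_le_of_injective (f := fun f => (⟨p f, hp f, fun hc =>
    hpc f (hc.mono (inter_subset_inter_left _ (hRn f 0)))⟩ :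
      ↥{X ∈ P' i | ¬ (Q ∩ X).Countable})) fun f f' hff' => ?_
  have hpp : p f = p f' := congrArg Subtype.val hff'
  by_contra hne'
  have hex : ∃ n, f n ≠ f' n := by
    by_contra! h
    exact hne' (funext h)
  classical
  let n := Nat.find hex
  have hn : f n ≠ f' n := Nat.find_spec hex
  have hpath : ∀ m ≤ n, path f m = path f' m := by
    intro m
    induction m with
    | zero => exact fun _ => rfl
    | succ m ih =>
      intro hm
      have h1 : f m = f' m := not_not.1 (Nat.find_min hex (Nat.lt_of_succ_le hm))
      have h2 := ih (Nat.le_of_succ_le hm)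
      change f m :: path f m = f' m :: path f' m
      rw [h1, h2]
  obtain ⟨Z, hZ, hpZ⟩ := href i _ (hi' (path f n)) (p f) (hp f)
  have key : ∀ h : ℕ → Bool, path h n = path f n → p h = p f →
      X (node (path f n)) (h n) = Z := by
    intro h hh hph
    refine (hP _).eq_of_not_countable (hX _ _).1 hZ (hpc h) ?_ ?_
    · refine inter_subset_left.trans ((hRn h (n + 1)).trans ?_)
      change X (node (path h n)) (h n) ∩ _ ⊆ _
      rw [hh]
      exact inter_subset_left
    · rw [hph]
      exact inter_subset_right.trans hpZ
  have h1 := key f rfl rfl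
  have h2 := key f' (hpath n le_rfl).symm hpp.symm
  have h3 := hne (node (path f n))
  cases hf : f n <;> cases hf' : f' n <;> simp_all

/-- `c` is the cardinality of a family of open dense sets of *-segments whose intersection is not
dense. -/
def IsNondistributive (c : Cardinal.{0}) : Prop :=
  ∃ ι : Type, Cardinal.mk ι = c ∧ ∃ 𝒟 : ι → Set (Set (Set ℕ)), (∀ i, IsOpenDense (𝒟 i)) ∧
    ∃ Q₀, IsStarSeg Q₀ ∧ ∀ Q ⊆ Q₀, IsStarSeg Q → ∃ i, Q ∉ 𝒟 i

theorem isNondistributive_of_not_isVZero {F : Set (Set (Set ℕ))} (hF : ∀ S ∈ F, IsVZero S)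
    (hU : ¬ IsVZero (⋃₀ F)) : IsNondistributive (Cardinal.mk F) := by
  refine ⟨F, rfl, fun S => {Q | Q ∩ S.1 = ∅}, fun S => (hF S.1 S.2).isOpenDense, ?_⟩
  by_contra! h
  refine hU fun A B hAB => ?_
  obtain ⟨Q, hQA, hQ, hQF⟩ := h _ ⟨A, B, hAB, rfl⟩
  have hint : StarSeg A B ∩ Q = Q := inter_eq_right.2 hQA
  obtain ⟨C, D, hCD, hC, hD, hCDQ⟩ :=
    exists_Seg_subset_of_inter hAB hQ (by rw [hint]; exact hQ.not_countable)
  refine ⟨C, D, hCD, Seg_mono hC hD, eq_empty_iff_forall_notMem.2 ?_⟩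
  rintro x ⟨hx, S, hS, hxS⟩
  have hxQ : x ∈ Q := hint ▸ hCDQ ▸ Seg_subset_StarSeg _ _ hx
  exact eq_empty_iff_forall_notMem.1 (hQF ⟨S, hS⟩) x ⟨hxQ, hxS⟩

theorem isNondistributive_of_shattering {H : Set (Set (Set (Set ℕ)))} (hH : Shattering H) :
    IsNondistributive (Cardinal.mk H) := by
  have hseg : IsSeg ∅ univ := ⟨empty_subset _, by simpa using infinite_univ⟩
  refine ⟨H, rfl, fun P => {Q | ∃ X ∈ P.1, Q ⊆ X}, fun P => (hH.1 P.1 P.2).isOpenDense,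
    _, ⟨∅, univ, hseg, rfl⟩, ?_⟩
  rintro _ - ⟨A, B, hAB, rfl⟩
  obtain ⟨P, hP, X, hX, Y, hY, hne, hXA, hYA, -⟩ := hH.2 A B hAB
  refine ⟨⟨P, hP⟩, ?_⟩
  rintro ⟨Z, hZ, hAZ⟩
  have key : ∀ W ∈ P, IsStarSeg (W ∩ StarSeg A B) → W = Z := fun W hW hWs =>
    (hH.1 P hP).eq_of_not_countable hW hZ hWs.not_countable inter_subset_left
      (inter_subset_right.trans hAZ)
  exact hne ((key X hX hXA).trans (key Y hY hYA).symm)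

theorem exists_not_isVZero_of_isNondistributive {c : Cardinal.{0}} (hc : IsNondistributive c)
    (hmin : ∀ d < c, ¬ IsNondistributive d) :
    ∃ F : Set (Set (Set ℕ)), (∀ S ∈ F, IsVZero S) ∧ ¬ IsVZero (⋃₀ F) ∧ Cardinal.mk F ≤ c := by
  obtain ⟨ι₀, hι₀, 𝒟₀, h𝒟₀, Q₀, hQ₀, hno₀⟩ := hc
  obtain ⟨e⟩ : Nonempty (c.ord.ToType ≃ ι₀) := by
    rw [← Cardinal.eq, Cardinal.mk_ord_toType, hι₀]
  choose P hPsub hP using fun i => (h𝒟₀ (e i)).exists_isVPartition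
  have hno : ∀ Q, IsStarSeg Q → Q ⊆ Q₀ → ∃ i, ¬ ∃ X ∈ P i, Q ⊆ X := by
    intro Q hQ hQQ
    obtain ⟨j, hj⟩ := hno₀ Q hQQ hQ
    refine ⟨e.symm j, fun ⟨X, hX, hQX⟩ => hj ?_⟩
    have := (h𝒟₀ _).1 X (hPsub _ hX) Q hQX hQ
    rwa [e.apply_symm_apply] at this
  let ℰ : c.ord.ToType → Set (Set (Set ℕ)) := fun i => {Q | ∀ j ≤ i, ∃ X ∈ P j, Q ⊆ X}
  have hℰ : ∀ i, IsOpenDense (ℰ i) := by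
    intro i
    have hlt : IsOpenDense {Q | ∀ j < i, ∃ X ∈ P j, Q ⊆ X} := by
      refine ⟨fun Q hQ R hR _ j hj => (hQ j hj).imp fun X hX => ⟨hX.1, hR.trans hX.2⟩,
        fun Q hQ => ?_⟩
      by_contra! hcon
      refine hmin _ (mk_Iio_ord_lt i) ⟨Iio i, rfl,
        fun j => {Q | ∃ X ∈ P j, Q ⊆ X}, fun j => (hP j).isOpenDense, Q, hQ, fun R hR hRs => ?_⟩
      by_contra! hall
      exact hcon R hR hRs fun j hj => hall ⟨j, hj⟩
    convert hlt.inter (hP i).isOpenDense using 1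
    ext Q
    constructor
    · exact fun h => ⟨fun j hj => h j hj.le, h i le_rfl⟩
    · rintro ⟨h1, h2⟩ j hj
      rcases hj.lt_or_eq with h | rfl
      exacts [h1 j h, h2]
  choose P' hP'sub hP' using fun i => (hℰ i).exists_isVPartition
  have hbdd : ∀ a : ℕ → c.ord.ToType, ∃ i, ∀ n, a n ≤ i := by
    intro a
    by_contra! hcon
    obtain ⟨R, hRQ, hR, hall⟩ := exists_forall_mem_of_nat (fun n => hℰ (a n)) hQ₀
    obtain ⟨i, hi⟩ := hno R hR hRQ
    obtain ⟨n, hn⟩ := hcon i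
    exact hi (hall n i hn.le)
  choose S hS hSmeet using fun i => (hP' i).exists_isVZero
  refine ⟨range S, ?_, fun hU => ?_, Cardinal.mk_range_le.trans (Cardinal.mk_ord_toType c).le⟩
  · rintro _ ⟨i, rfl⟩
    exact hS i
  · obtain ⟨A, B, hAB, rfl⟩ := hQ₀
    obtain ⟨C, D, hCD, hsub, hemp⟩ := hU A B hAB
    obtain ⟨hAC, hDB⟩ := subset_of_Seg_subset hCD hsub
    obtain ⟨i, hi⟩ := exists_continuum_le_mk hP hP' (fun i j hj Q hQ => hP'sub i hQ j hj) hno hbdd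
      ⟨C, D, hCD, rfl⟩ (StarSeg_mono (.of_subset hAC) (.of_subset hDB))
    obtain ⟨x, hx, hxS⟩ := hSmeet i C D hCD hi
    exact eq_empty_iff_forall_notMem.1 hemp x ⟨hx, S i, ⟨i, rfl⟩, hxS⟩

/-- The *-segments below a fixed one look like all the *-segments: a failure of distributivity
below one *-segment gives a failure everywhere. -/
theorem IsNondistributive.exists_isOpenDense {c : Cardinal.{0}} (hc : IsNondistributive c) :
    ∃ ι : Type, Cardinal.mk ι = c ∧ ∃ 𝒟 : ι → Set (Set (Set ℕ)), (∀ i, IsOpenDense (𝒟 i)) ∧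
      ∀ Q, IsStarSeg Q → ∃ i, Q ∉ 𝒟 i := by
  obtain ⟨ι, hι, 𝒟, h𝒟, _, ⟨A, B, hAB, rfl⟩, hno⟩ := hc
  obtain ⟨e, he, hrange⟩ : ∃ e : ℕ → ℕ, Function.Injective e ∧ range e = B \ A := by
    have := hAB.2.to_subtype
    obtain ⟨f⟩ : Nonempty (ℕ ≃ ↥(B \ A)) := nonempty_equiv_of_countable
    exact ⟨fun n => f n, Subtype.val_injective.comp f.injective, by
      ext z; exact ⟨by rintro ⟨n, rfl⟩; exact (f n).2, fun hz => ⟨f.symm ⟨z, hz⟩, by simp⟩⟩⟩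
  have heA : ∀ n, e n ∉ A := fun n => (hrange.subset ⟨n, rfl⟩).2
  have heB : ∀ n, e n ∈ B := fun n => (hrange.subset ⟨n, rfl⟩).1
  let φ : Set ℕ → Set ℕ := fun C => A ∪ e '' C
  have hφ : ∀ C D, φ D \ φ C = e '' (D \ C) := by
    intro C D
    ext z
    constructor
    · rintro ⟨h1 | ⟨n, hn, rfl⟩, h2⟩
      · exact absurd (.inl h1) h2
      · exact ⟨n, ⟨hn, fun hC => h2 (.inr ⟨n, hC, rfl⟩)⟩, rfl⟩
    · rintro ⟨n, ⟨hD, hC⟩, rfl⟩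
      refine ⟨.inr ⟨n, hD, rfl⟩, ?_⟩
      rintro (h | ⟨m, hm, h⟩)
      exacts [heA n h, hC (he h ▸ hm)]
  have hφseg : ∀ {C D}, IsSeg C D → IsSeg (φ C) (φ D) := fun {C D} h =>
    ⟨union_subset_union_right _ (image_mono h.1), by
      rw [hφ]; exact h.2.image he.injOn⟩
  have hφalm : ∀ {C D}, AlmostSub C D → AlmostSub (φ C) (φ D) := fun {C D} h => by
    rw [AlmostSub, hφ]; exact Set.Finite.image _ h
  have hφsub : ∀ {C D C' D'}, IsSeg C' D' → StarSeg C' D' ⊆ StarSeg C D →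
      StarSeg (φ C') (φ D') ⊆ StarSeg (φ C) (φ D) := fun h hs =>
    StarSeg_mono (hφalm (almostSub_of_StarSeg_subset h hs).1)
      (hφalm (almostSub_of_StarSeg_subset h hs).2)
  refine ⟨ι, hι, fun i => {Q | IsStarSeg Q ∧ ∀ C D, IsSeg C D → StarSeg C D = Q →
    StarSeg (φ C) (φ D) ∈ 𝒟 i}, fun i => ⟨?_, ?_⟩, ?_⟩
  · rintro _ ⟨⟨E, F, hEF, rfl⟩, hmem⟩ R hR hRs
    refine ⟨hRs, fun C D hCD hCDR => ?_⟩
    exact (h𝒟 i).1 _ (hmem E F hEF rfl) _ (hφsub hCD (hCDR ▸ hR)) ⟨_, _, hφseg hCD, rfl⟩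
  · rintro _ ⟨C, D, hCD, rfl⟩
    obtain ⟨R, hRsub, hR, hRD⟩ := (h𝒟 i).2 _ ⟨_, _, hφseg hCD, rfl⟩
    have hint : StarSeg (φ C) (φ D) ∩ R = R := inter_eq_right.2 hRsub
    obtain ⟨C₁, D₁, hCD₁, hC₁, hD₁, heq⟩ := exists_Seg_subset_of_inter (hφseg hCD) hR
      (by rw [hint]; exact hR.not_countable)
    rw [hint] at heq
    have hpre : ∀ E, φ C ⊆ E → E ⊆ φ D → φ (e ⁻¹' E) = E := by
      intro E h1 h2
      ext z
      constructor
      · rintro (h | ⟨n, hn, rfl⟩)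
        exacts [h1 (.inl h), hn]
      · intro hz
        rcases h2 hz with h | ⟨n, -, rfl⟩
        exacts [.inl h, .inr ⟨n, hz, rfl⟩]
    have hC₁' := hpre C₁ hC₁ (hCD₁.1.trans hD₁)
    have hD₁' := hpre D₁ (hC₁.trans hCD₁.1) hD₁
    have hseg : IsSeg (e ⁻¹' C₁) (e ⁻¹' D₁) := by
      refine ⟨preimage_mono hCD₁.1, fun hfin => hCD₁.2 ?_⟩
      rw [← hC₁', ← hD₁', hφ]
      exact hfin.image _
    refine ⟨_, StarSeg_mono (C := e ⁻¹' C₁) (D := e ⁻¹' D₁) (.of_subset fun n hn =>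
      hC₁ (.inr ⟨n, hn, rfl⟩)) (.of_subset fun n hn => ?_), ⟨_, _, hseg, rfl⟩,
      ⟨_, _, hseg, rfl⟩, ?_⟩
    · rcases hD₁ hn with h | ⟨m, hm, h⟩
      exacts [absurd h (heA n), he h ▸ hm]
    · intro C₂ D₂ hCD₂ h₂
      refine (h𝒟 i).1 R hRD _ ?_ ⟨_, _, hφseg hCD₂, rfl⟩
      have := hφsub hCD₂ h₂.subset
      rwa [hC₁', hD₁', heq] at this
  · rintro _ ⟨C, D, hCD, rfl⟩
    have hsub : StarSeg (φ C) (φ D) ⊆ StarSeg A B := StarSeg_mono (.of_subset subset_union_left)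
      (.of_subset (union_subset hAB.1 (by rintro _ ⟨n, -, rfl⟩; exact heB n)))
    obtain ⟨i, hi⟩ := hno _ hsub ⟨_, _, hφseg hCD, rfl⟩
    exact ⟨i, fun h => hi (h.2 C D hCD rfl)⟩

theorem IsNondistributive.exists_shattering {c : Cardinal.{0}} (hc : IsNondistributive c) :
    ∃ H, Shattering H ∧ Cardinal.mk H ≤ c := by
  obtain ⟨ι, rfl, 𝒟, h𝒟, hno⟩ := hc.exists_isOpenDense
  choose P hPsub hP using fun i => (h𝒟 i).exists_isVPartition
  refine ⟨range P, ⟨?_, fun A B hAB => ?_⟩, Cardinal.mk_range_le⟩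
  · rintro _ ⟨i, rfl⟩
    exact hP i
  · have hQ : IsStarSeg (StarSeg A B) := ⟨A, B, hAB, rfl⟩
    obtain ⟨i, hi⟩ := hno _ hQ
    obtain ⟨X, hX, Y, hY, hne, hXA, hYA⟩ := (hP i).exists_two hQ
      fun ⟨X, hX, hQX⟩ => hi ((h𝒟 i).1 X (hPsub i hX) _ hQX hQ)
    refine ⟨P i, ⟨i, rfl⟩, X, hX, Y, hY, hne, hXA, hYA, fun heq => hne ?_⟩
    exact (hP i).eq_of_not_countable hX hY hXA.not_countable inter_subset_left
      (heq ▸ inter_subset_left)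

theorem isNondistributive_nonempty : {c | IsNondistributive c}.Nonempty := by
  refine ⟨_, isNondistributive_of_not_isVZero (F := range fun x : Set ℕ => {x}) ?_ fun h => ?_⟩
  · rintro _ ⟨x, rfl⟩
    refine isVZero_of_mk_lt_continuum ?_
    rw [Cardinal.mk_singleton]
    exact Cardinal.one_lt_aleph0.trans Cardinal.aleph0_lt_continuum
  · obtain ⟨C, D, hCD, -, hemp⟩ := h ∅ univ ⟨empty_subset _, by simpa using infinite_univ⟩
    exact eq_empty_iff_forall_notMem.1 hemp D ⟨hCD.right_mem, {D}, ⟨D, rfl⟩, rfl⟩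

theorem kappaV_eq_sInf : kappaV = sInf {c | IsNondistributive c} := by
  have hmem : IsNondistributive (sInf {c | IsNondistributive c}) :=
    csInf_mem isNondistributive_nonempty
  obtain ⟨H, hH, hle⟩ := hmem.exists_shattering
  refine ((show kappaV ≤ _ from csInf_le' ⟨H, hH, rfl⟩).trans hle).antisymm
    (le_csInf ⟨_, H, hH, rfl⟩ ?_)
  rintro _ ⟨H', hH', rfl⟩
  exact csInf_le' (isNondistributive_of_shattering hH')

theorem addV0_eq_sInf : addV0 = sInf {c | IsNondistributive c} := by
  have hmem : IsNondistributive (sInf {c | IsNondistributive c}) :=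
    csInf_mem isNondistributive_nonempty
  obtain ⟨F, hF, hU, hle⟩ := exists_not_isVZero_of_isNondistributive hmem
    fun d hd => notMem_of_lt_csInf' (s := {c | IsNondistributive c}) hd
  refine ((show addV0 ≤ _ from csInf_le' ⟨F, hF, hU, rfl⟩).trans hle).antisymm
    (le_csInf ⟨_, F, hF, hU, rfl⟩ ?_)
  rintro _ ⟨G, hG, hGU, rfl⟩
  exact csInf_le' (isNondistributive_of_not_isVZero hG hGU)

/-- Theorem 15: `κ(v) = add(v⁰)`. -/
theorem kappaV_eq_addV0 : kappaV = addV0 := by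
  rw [kappaV_eq_sInf, addV0_eq_sInf]
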